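/- arXiv:0704.3092 — 2 statements merged into one kernel-verified Lean document; each statement's English description precedes it below -/
import Mathlib

section
/- Let X be a C*-algebra, E a norm-closed subalgebra of X, D a norm-closed two-sided ideal of E, and B a norm-closed subalgebra of E. Suppose there is a net (e_t) in B ∩ D with ‖e_t‖ ≤ 1 for all t such that ‖e_t·d − d‖ → 0 and ‖d·e_t − d‖ → 0 for every d ∈ D. Then for every b ∈ B with dist(b, D) ≤ 1 there exists b' ∈ B with ‖b'‖ ≤ 1 and b − b' ∈ D. (That is, the quotient map E → E/D carries the closed unit ball of B onto the closed unit ball of the image of B in E/D.) -/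
open Filter Topology Metric

/-- `S` is a norm-closed (not necessarily self-adjoint or unital) subalgebra:
a norm-closed ℂ-linear subspace closed under multiplication. -/
structure IsClosedSubalg (X : Type*) [NonUnitalNormedRing X] [NormedSpace ℂ X]
    (S : Set X) : Prop where
  isClosed : IsClosed S
  zero_mem : (0 : X) ∈ S
  add_mem : ∀ {x y : X}, x ∈ S → y ∈ S → x + y ∈ S
  smul_mem : ∀ (c : ℂ) {x : X}, x ∈ S → c • x ∈ S
  mul_mem : ∀ {x y : X}, x ∈ S → y ∈ S → x * y ∈ S

/-- A contractive net drawn from `A` which is a two-sided approximate identity for `D`. -/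
def IsCaiFor (X : Type*) [NonUnitalNormedRing X] (A D : Set X) : Prop :=
  ∃ (ι : Type) (l : Filter ι) (e : ι → X), l.NeBot ∧
    (∀ t, e t ∈ A) ∧ (∀ t, ‖e t‖ ≤ 1) ∧
    (∀ d ∈ D, Tendsto (fun t => ‖e t * d - d‖) l (𝓝 0)) ∧
    (∀ d ∈ D, Tendsto (fun t => ‖d * e t - d‖) l (𝓝 0))

section CStar

variable {X : Type*} [NonUnitalCStarAlgebra X]

lemma norm_sum_sq_le_of_almost_orthogonal {w : ℕ → X} {M κ : ℝ} (hκ : 0 ≤ κ)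
    (hw : ∀ i, ‖w i‖ ≤ M) (hwκ : ∀ i j, i < j → ‖star (w j) * w i‖ ≤ κ) (n : ℕ) :
    ‖∑ i ∈ Finset.range n, w i‖ ^ 2 ≤ n * M ^ 2 + n ^ 2 * κ := by
  have hterm : ∀ i j, ‖star (w i) * w j‖ ≤ (if i = j then M ^ 2 else 0) + κ := by
    intro i j
    rcases lt_trichotomy i j with h | rfl | h
    · rw [if_neg h.ne, zero_add, ← norm_star, star_mul, star_star]
      exact hwκ i j h
    · rw [if_pos rfl, CStarRing.norm_star_mul_self, ← sq]
      have := pow_le_pow_left₀ (norm_nonneg _) (hw i) 2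
      linarith
    · rw [if_neg h.ne', zero_add]
      exact hwκ j i h
  calc ‖∑ i ∈ Finset.range n, w i‖ ^ 2
      = ‖∑ i ∈ Finset.range n, ∑ j ∈ Finset.range n, star (w i) * w j‖ := by
        rw [sq, ← CStarRing.norm_star_mul_self, star_sum, Finset.sum_mul_sum]
    _ ≤ ∑ i ∈ Finset.range n, ∑ j ∈ Finset.range n, ((if i = j then M ^ 2 else 0) + κ) :=
        norm_sum_le_of_le _ fun i _ => norm_sum_le_of_le _ fun j _ => hterm i j
    _ = n * M ^ 2 + n ^ 2 * κ := by
        simp only [Finset.sum_add_distrib, Finset.sum_ite_eq, Finset.sum_const,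
          Finset.card_range, nsmul_eq_mul]
        rw [Finset.sum_congr rfl fun i hi => if_pos hi]
        simp only [Finset.sum_const, Finset.card_range, nsmul_eq_mul]
        ring

lemma norm_average_le_of_almost_orthogonal {w : ℕ → X} {M η : ℝ} (hη : 0 ≤ η)
    (hw : ∀ i, ‖w i‖ ≤ M) (hwη : ∀ i j, i < j → ‖star (w j) * w i‖ ≤ η ^ 2 / 2)
    {n : ℕ} (hn : 0 < n) (hMn : M ^ 2 ≤ n * (η ^ 2 / 2)) :
    ‖(n : ℝ)⁻¹ • ∑ i ∈ Finset.range n, w i‖ ≤ η := by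
  have hn' : (0 : ℝ) < n := Nat.cast_pos.mpr hn
  have h := norm_sum_sq_le_of_almost_orthogonal (by positivity) hw hwη n
  rw [norm_smul, norm_inv, Real.norm_natCast, inv_mul_le_iff₀ hn']
  refine le_of_sq_le_sq ?_ (by positivity)
  nlinarith

lemma norm_average_le {V : Type*} [NormedAddCommGroup V] [NormedSpace ℝ V] {w : ℕ → V} {η : ℝ}
    (hw : ∀ i, ‖w i‖ ≤ η) {n : ℕ} (hn : 0 < n) :
    ‖(n : ℝ)⁻¹ • ∑ i ∈ Finset.range n, w i‖ ≤ η := by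
  have hn' : (0 : ℝ) < n := Nat.cast_pos.mpr hn
  rw [norm_smul, norm_inv, Real.norm_natCast, inv_mul_le_iff₀ hn']
  simpa using norm_sum_le_of_le (Finset.range n) fun i _ => hw i

lemma IsClosedSubalg.sub_mem {S : Set X} (hS : IsClosedSubalg X S) {x y : X} (hx : x ∈ S)
    (hy : y ∈ S) : x - y ∈ S := by
  simpa [sub_eq_add_neg] using hS.add_mem hx (hS.smul_mem (-1) hy)

lemma IsClosedSubalg.real_smul_mem {S : Set X} (hS : IsClosedSubalg X S) (r : ℝ) {x : X}
    (hx : x ∈ S) : r • x ∈ S := by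
  simpa using hS.smul_mem (r : ℂ) hx

lemma IsClosedSubalg.sum_mem {S : Set X} (hS : IsClosedSubalg X S) {ι : Type*} (s : Finset ι)
    {x : ι → X} (hx : ∀ i, x i ∈ S) : ∑ i ∈ s, x i ∈ S :=
  Finset.sum_induction x (· ∈ S) (fun _ _ => hS.add_mem) hS.zero_mem fun i _ => hx i

lemma IsClosedSubalg.inter {S T : Set X} (hS : IsClosedSubalg X S) (hT : IsClosedSubalg X T) :
    IsClosedSubalg X (S ∩ T) where
  isClosed := hS.isClosed.inter hT.isClosed
  zero_mem := ⟨hS.zero_mem, hT.zero_mem⟩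
  add_mem hx hy := ⟨hS.add_mem hx.1 hy.1, hT.add_mem hx.2 hy.2⟩
  smul_mem c _ hx := ⟨hS.smul_mem c hx.1, hT.smul_mem c hx.2⟩
  mul_mem hx hy := ⟨hS.mul_mem hx.1 hy.1, hT.mul_mem hx.2 hy.2⟩

lemma tendsto_mul_of_tendsto_of_norm_le_one {ι : Type*} {l : Filter ι} {u : ι → X}
    (hu : ∀ t, ‖u t‖ ≤ 1) {v : ι → X} {x y : X}
    (hux : Tendsto (fun t => u t * x) l (𝓝 y)) (hv : Tendsto v l (𝓝 x)) :
    Tendsto (fun t => u t * v t) l (𝓝 y) := by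
  have h : Tendsto (fun t => u t * (v t - x)) l (𝓝 0) := by
    rw [tendsto_iff_norm_sub_tendsto_zero] at hv
    refine squeeze_zero_norm (fun t => ?_) hv
    exact (norm_mul_le _ _).trans (mul_le_of_le_one_left (norm_nonneg _) (hu t))
  simpa [mul_sub] using h.add hux

variable (X) in
/-- `c` bounds, up to an arbitrarily small error, the norms of the operator convex combinations
`(1 - f) y + f z` with coefficient `f` almost commuting with `y` and `z`. -/
def IsAlmostConvexBound [PartialOrder X] (c : ℝ) : Prop :=
  ∀ R : ℝ, 0 ≤ R → ∀ η : ℝ, 0 < η → ∃ κ : ℝ, 0 < κ ∧ ∀ f y z : X, 0 ≤ f → ‖f‖ ≤ 1 →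
    ‖y‖ ≤ R → ‖z‖ ≤ R → ‖f * y - y * f‖ ≤ κ → ‖f * z - z * f‖ ≤ κ →
    ‖y - f * y + f * z‖ ≤ c * R + η

lemma isAlmostConvexBound_three [PartialOrder X] : IsAlmostConvexBound X 3 := by
  intro R hR η hη
  refine ⟨1, one_pos, fun f y z _ hf1 hy hz _ _ => ?_⟩
  have hmul : ∀ {x : X}, ‖x‖ ≤ R → ‖f * x‖ ≤ R := fun {x} hx =>
    (norm_mul_le f x).trans (by nlinarith [norm_nonneg x])
  linarith [norm_add_le (y - f * y) (f * z), norm_sub_le y (f * y), hmul hy, hmul hz]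

variable [PartialOrder X] [StarOrderedRing X]

lemma mul_self_le_self_of_norm_le_one {f : X} (hf : 0 ≤ f) (hf1 : ‖f‖ ≤ 1) : f * f ≤ f := by
  obtain ⟨g, rfl⟩ := CStarAlgebra.nonneg_iff_eq_star_mul_self.mp hf
  have h := CStarAlgebra.star_left_conjugate_le_norm_smul (a := g) (b := g * star g)
    (IsSelfAdjoint.mul_star_self g)
  have h1 : ‖g * star g‖ ≤ 1 := by
    rwa [CStarRing.norm_self_mul_star, ← CStarRing.norm_star_mul_self]
  calc star g * g * (star g * g) = star g * (g * star g) * g := by simp only [mul_assoc]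
    _ ≤ ‖g * star g‖ • (star g * g) := h
    _ ≤ (1 : ℝ) • (star g * g) := smul_le_smul_of_nonneg_right h1 hf
    _ = star g * g := one_smul _ _

lemma star_mul_self_convex_le {f : X} (hf : 0 ≤ f) (hf1 : ‖f‖ ≤ 1) (y z : X) :
    star (y - f * y + f * z) * (y - f * y + f * z) ≤
      star y * y - star y * f * y + star z * f * z := by
  have h := star_left_conjugate_nonneg
    (sub_nonneg.mpr (mul_self_le_self_of_norm_le_one hf hf1)) (y - z)
  have hs : star f = f := (IsSelfAdjoint.of_nonneg hf).star_eq
  rw [← sub_nonneg]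
  convert h using 1
  simp only [star_sub, star_add, star_mul, hs]
  noncomm_ring

lemma norm_sq_le_of_almost_commute {f : X} (hf : 0 ≤ f) (hf1 : ‖f‖ ≤ 1) {y z : X} {R κ : ℝ}
    (hy : ‖y‖ ≤ R) (hz : ‖z‖ ≤ R) (hfy : ‖f * y - y * f‖ ≤ κ) (hfz : ‖f * z - z * f‖ ≤ κ) :
    ‖y - f * y + f * z‖ ^ 2 ≤
      ‖star y * y - f * (star y * y) + f * (star z * z)‖ + 2 * (κ * R) := by
  have hs : star f = f := (IsSelfAdjoint.of_nonneg hf).star_eq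
  have key : ∀ {x : X}, ‖x‖ ≤ R → ‖f * x - x * f‖ ≤ κ →
      ‖(f * star x - star x * f) * x‖ ≤ κ * R := by
    intro x hx hfx
    have h2 : ‖f * star x - star x * f‖ ≤ κ := by
      rw [← norm_star, ← norm_neg]
      simpa [hs] using hfx
    exact (norm_mul_le _ _).trans
      (mul_le_mul h2 hx (norm_nonneg _) ((norm_nonneg _).trans h2))
  have h1 := CStarAlgebra.norm_le_norm_of_nonneg_of_le (star_mul_self_nonneg _)
    (star_mul_self_convex_le hf hf1 y z)
  rw [CStarRing.norm_star_mul_self, ← sq] at h1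
  have h2 : star y * y - star y * f * y + star z * f * z =
      (star y * y - f * (star y * y) + f * (star z * z)) +
        (f * star y - star y * f) * y - (f * star z - star z * f) * z := by
    noncomm_ring
  rw [h2] at h1
  have h3 := norm_sub_le ((star y * y - f * (star y * y) + f * (star z * z)) +
        (f * star y - star y * f) * y) ((f * star z - star z * f) * z)
  have h4 := norm_add_le (star y * y - f * (star y * y) + f * (star z * z))
        ((f * star y - star y * f) * y)
  linarith [key hy hfy, key hz hfz]

lemma norm_commutator_star_mul_self_le {f : X} (hf : 0 ≤ f) {y : X} {R κ : ℝ}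
    (hy : ‖y‖ ≤ R) (hfy : ‖f * y - y * f‖ ≤ κ) :
    ‖f * (star y * y) - star y * y * f‖ ≤ 2 * (κ * R) := by
  have hs : star f = f := (IsSelfAdjoint.of_nonneg hf).star_eq
  have hκ : 0 ≤ κ := (norm_nonneg _).trans hfy
  have h2 : ‖f * star y - star y * f‖ ≤ κ := by
    rw [← norm_star, ← norm_neg]
    simpa [hs] using hfy
  have h : f * (star y * y) - star y * y * f =
      (f * star y - star y * f) * y + star y * (f * y - y * f) := by noncomm_ring
  rw [h]
  have h3 := norm_mul_le (f * star y - star y * f) y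
  have h4 := norm_mul_le (star y) (f * y - y * f)
  rw [norm_star] at h4
  have h5 : ‖f * star y - star y * f‖ * ‖y‖ ≤ κ * R :=
    mul_le_mul h2 hy (norm_nonneg _) hκ
  have h6 : ‖y‖ * ‖f * y - y * f‖ ≤ R * κ :=
    mul_le_mul hy hfy (norm_nonneg _) ((norm_nonneg _).trans hy)
  linarith [norm_add_le ((f * star y - star y * f) * y) (star y * (f * y - y * f))]

lemma IsAlmostConvexBound.sqrt {c : ℝ} (hc0 : 0 ≤ c) (hc : IsAlmostConvexBound X c) :
    IsAlmostConvexBound X (√c) := by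
  intro R hR η hη
  obtain ⟨κ, hκ, h⟩ := hc (R ^ 2) (sq_nonneg R) (η ^ 2 / 2) (by positivity)
  set m : ℝ := min κ (η ^ 2 / 2) with hm
  have hm0 : 0 < m := lt_min hκ (by positivity)
  refine ⟨m / (2 * (R + 1)), by positivity, fun f y z hf hf1 hy hz hfy hfz => ?_⟩
  have hmR : 2 * (m / (2 * (R + 1)) * R) ≤ m := by
    have : 2 * (m / (2 * (R + 1)) * R) = m * (R / (R + 1)) := by field_simp
    rw [this]
    exact mul_le_of_le_one_right hm0.le ((div_le_one (by positivity)).mpr (by linarith))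
  have hsq : ∀ {x : X}, ‖x‖ ≤ R → ‖star x * x‖ ≤ R ^ 2 := fun {x} hx => by
    rw [CStarRing.norm_star_mul_self, ← sq]
    gcongr
  have h1 := norm_sq_le_of_almost_commute hf hf1 hy hz hfy hfz
  have h2 := h f (star y * y) (star z * z) hf hf1 (hsq hy) (hsq hz)
    ((norm_commutator_star_mul_self_le hf hy hfy).trans (hmR.trans (min_le_left _ _)))
    ((norm_commutator_star_mul_self_le hf hz hfz).trans (hmR.trans (min_le_left _ _)))
  have h3 : m ≤ η ^ 2 / 2 := min_le_right _ _
  refine le_of_sq_le_sq ?_ (by positivity)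
  have h4 : 0 ≤ √c * R * η := by positivity
  nlinarith [Real.sq_sqrt hc0]

lemma isAlmostConvexBound_of_one_lt {c : ℝ} (hc : 1 < c) : IsAlmostConvexBound X c := by
  have hiter : ∀ n : ℕ, 1 ≤ Real.sqrt^[n] 3 ∧ IsAlmostConvexBound X (Real.sqrt^[n] 3) := by
    intro n
    induction n with
    | zero => exact ⟨by norm_num, isAlmostConvexBound_three⟩
    | succ n ih =>
      rw [Function.iterate_succ_apply']
      exact ⟨Real.one_le_sqrt.mpr ih.1, ih.2.sqrt (by linarith [ih.1])⟩
  have hbound : ∀ n : ℕ, Real.sqrt^[n] 3 ≤ 1 + 2 * (1 / 2) ^ n := by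
    intro n
    induction n with
    | zero => norm_num
    | succ n ih =>
      rw [Function.iterate_succ_apply', Real.sqrt_le_iff, pow_succ]
      refine ⟨by positivity, ?_⟩
      nlinarith [sq_nonneg ((1 / 2 : ℝ) ^ n)]
  obtain ⟨n, hn⟩ := exists_pow_lt_of_lt_one (show 0 < (c - 1) / 2 by linarith)
    (show (1 / 2 : ℝ) < 1 by norm_num)
  intro R hR η hη
  obtain ⟨κ, hκ, h⟩ := (hiter n).2 R hR η hη
  refine ⟨κ, hκ, fun f y z hf hf1 hy hz hfy hfz => (h f y z hf hf1 hy hz hfy hfz).trans ?_⟩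
  have : Real.sqrt^[n] 3 ≤ c := (hbound n).trans (by linarith)
  gcongr

lemma norm_sub_star_mul_sq_le {e : X} (he : ‖e‖ ≤ 1) (d : X) :
    ‖star e * d - d‖ ^ 2 ≤ 2 * ‖d‖ * ‖e * d - d‖ := by
  have h := CStarAlgebra.star_left_conjugate_le_norm_smul (a := d) (b := e * star e)
    (IsSelfAdjoint.mul_star_self e)
  have h1 : ‖e * star e‖ ≤ 1 := by
    rw [CStarRing.norm_self_mul_star]
    exact mul_le_one₀ he (norm_nonneg _) he
  have h2 : star d * (e * star e) * d ≤ star d * d :=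
    h.trans ((smul_le_smul_of_nonneg_right h1 (star_mul_self_nonneg d)).trans_eq (one_smul _ _))
  have h3 : star (star e * d - d) * (star e * d - d) ≤
      -(star d * (e * d - d)) - star (e * d - d) * d := by
    rw [← sub_nonneg] at h2 ⊢
    convert h2 using 1
    simp only [star_sub, star_mul, star_star]
    noncomm_ring
  have h4 := CStarAlgebra.norm_le_norm_of_nonneg_of_le (star_mul_self_nonneg _) h3
  rw [CStarRing.norm_star_mul_self, ← sq] at h4
  have h5 := norm_sub_le (-(star d * (e * d - d))) (star (e * d - d) * d)
  have h6 := norm_mul_le (star d) (e * d - d)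
  have h7 := norm_mul_le (star (e * d - d)) d
  rw [norm_neg] at h5
  rw [norm_star] at h6 h7
  linarith

section ApproximateIdentity

variable {ι : Type*} {l : Filter ι} {e : ι → X} {D : Set X}

lemma tendsto_star_mul_of_tendsto_mul (he1 : ∀ t, ‖e t‖ ≤ 1) {d : X}
    (hd : Tendsto (fun t => e t * d) l (𝓝 d)) : Tendsto (fun t => star (e t) * d) l (𝓝 d) := by
  rw [tendsto_iff_norm_sub_tendsto_zero] at hd ⊢
  have h : Tendsto (fun t => ‖star (e t) * d - d‖ ^ 2) l (𝓝 0) :=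
    squeeze_zero (fun t => sq_nonneg _) (fun t => norm_sub_star_mul_sq_le (he1 t) d)
      (by simpa using hd.const_mul (2 * ‖d‖))
  simpa using h.sqrt

lemma tendsto_star_defect_mul (he1 : ∀ t, ‖e t‖ ≤ 1) {x : X}
    (hx : Tendsto (fun t => e t * x) l (𝓝 x)) :
    Tendsto (fun t => star (e t - e t * star (e t)) * x) l (𝓝 0) := by
  have h1 := tendsto_star_mul_of_tendsto_mul he1 hx
  have h2 := h1.sub (tendsto_mul_of_tendsto_of_norm_le_one he1 hx h1)
  simpa [sub_mul, mul_assoc] using h2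

lemma tendsto_star_commutator_mul [l.NeBot] (heD : ∀ t, e t ∈ D) (he1 : ∀ t, ‖e t‖ ≤ 1)
    (hl : ∀ d ∈ D, Tendsto (fun t => e t * d) l (𝓝 d))
    (hr : ∀ d ∈ D, Tendsto (fun t => d * e t) l (𝓝 d))
    {b : X} (hb : ∀ d ∈ D, d * b ∈ D) {x : X} (hx : x ∈ D) :
    Tendsto (fun t => star (b * e t - e t * b) * x) l (𝓝 0) := by
  have h1 := tendsto_star_mul_of_tendsto_mul he1 (hl x hx)
  have h2 : Tendsto (fun t => star b * (star (e t) * x)) l (𝓝 (star b * x)) :=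
    h1.const_mul _
  have hclosure : Tendsto (fun t => star (e t) * (star b * x)) l (𝓝 (star b * x)) := by
    rw [Metric.tendsto_nhds]
    intro ε hε
    obtain ⟨s, hs⟩ := ((Metric.tendsto_nhds.mp h2) (ε / 3) (by positivity)).exists
    have h3 : Tendsto (fun t => star (e t) * (star b * (star (e s) * x))) l
        (𝓝 (star b * (star (e s) * x))) := by
      have := ((hr _ (hb _ (heD s))).star).mul_const x
      simpa [mul_assoc] using this
    filter_upwards [(Metric.tendsto_nhds.mp h3) (ε / 3) (by positivity)] with t ht
    rw [dist_eq_norm] at hs ht ⊢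
    have h4 : ‖star (e t) * (star b * (star (e s) * x) - star b * x)‖ ≤
        ‖star b * (star (e s) * x) - star b * x‖ :=
      (norm_mul_le _ _).trans (mul_le_of_le_one_left (norm_nonneg _) (by simpa using he1 t))
    have h5 : star (e t) * (star b * x) - star b * x =
        (star (e t) * (star b * (star (e s) * x)) - star b * (star (e s) * x)) -
        star (e t) * (star b * (star (e s) * x) - star b * x) +
        (star b * (star (e s) * x) - star b * x) := by noncomm_ring
    rw [h5]
    refine (norm_add_le _ _).trans_lt ?_
    linarith [norm_sub_le (star (e t) * (star b * (star (e s) * x)) - star b * (star (e s) * x))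
      (star (e t) * (star b * (star (e s) * x) - star b * x))]
  simpa [sub_mul, mul_assoc] using hclosure.sub h2

lemma exists_almost_central_approximate_unit [l.NeBot] {A : Set X} (hA : IsClosedSubalg X A)
    (hAD : A ⊆ D) (heA : ∀ t, e t ∈ A) (he1 : ∀ t, ‖e t‖ ≤ 1)
    (hD : IsClosedSubalg X D)
    (hl : ∀ d ∈ D, Tendsto (fun t => e t * d) l (𝓝 d))
    (hr : ∀ d ∈ D, Tendsto (fun t => d * e t) l (𝓝 d))
    {b : X} (hb : ∀ d ∈ D, d * b ∈ D ∧ b * d ∈ D) {d : X} (hd : d ∈ D) {η : ℝ} (hη : 0 < η) :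
    ∃ u ∈ A, ∃ f : X, 0 ≤ f ∧ ‖f‖ ≤ 1 ∧ ‖u‖ ≤ 1 ∧ ‖u - f‖ ≤ η ∧ ‖b * u - u * b‖ ≤ η ∧
      ‖u * d - d‖ ≤ η ∧ ‖d * u - d‖ ≤ η := by
  have heD : ∀ t, e t ∈ D := fun t => hAD (heA t)
  set p : ι → X := fun t => e t - e t * star (e t) with hp
  set c : ι → X := fun t => b * e t - e t * b with hc
  have hpl : ∀ s, Tendsto (fun t => star (p t) * p s) l (𝓝 0) := fun s =>
    tendsto_star_defect_mul he1 (by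
      simpa [hp, mul_sub, mul_assoc] using
        (hl _ (heD s)).sub ((hl _ (heD s)).mul_const (star (e s))))
  have hcl : ∀ s, Tendsto (fun t => star (c t) * c s) l (𝓝 0) := fun s =>
    tendsto_star_commutator_mul heD he1 hl hr (fun d hd => (hb d hd).1)
      (hD.sub_mem (hb _ (heD s)).2 (hb _ (heD s)).1)
  have hη2 : 0 < η ^ 2 / 2 := by positivity
  have hsmall : ∀ {g : ι → X} {x : X}, Tendsto g l (𝓝 x) → ∀ {κ : ℝ}, 0 < κ →
      ∀ᶠ t in l, ‖g t - x‖ ≤ κ := fun hg κ hκ => by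
    filter_upwards [(Metric.tendsto_nhds.mp hg) κ hκ] with t ht
    rw [dist_eq_norm] at ht
    exact ht.le
  obtain ⟨t, ht, htt⟩ := exists_seq_of_forall_finset_exists
    (fun t => ‖e t * d - d‖ ≤ η ∧ ‖d * e t - d‖ ≤ η)
    (fun s t => ‖star (p t) * p s‖ ≤ η ^ 2 / 2 ∧ ‖star (c t) * c s‖ ≤ η ^ 2 / 2) (by
      intro s _
      have hs : ∀ᶠ t in l, ∀ x ∈ s,
          ‖star (p t) * p x‖ ≤ η ^ 2 / 2 ∧ ‖star (c t) * c x‖ ≤ η ^ 2 / 2 := by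
        rw [Filter.eventually_all_finset]
        intro x _
        filter_upwards [hsmall (hpl x) hη2, hsmall (hcl x) hη2] with t h1 h2
        exact ⟨by simpa using h1, by simpa using h2⟩
      obtain ⟨t, h1, h2, h3⟩ :=
        ((hsmall (hl d hd) hη).and ((hsmall (hr d hd) hη).and hs)).exists
      exact ⟨t, ⟨h1, h2⟩, h3⟩)
  obtain ⟨n, hn⟩ := exists_nat_ge (max 1 ((2 + 2 * ‖b‖) ^ 2 / (η ^ 2 / 2)))
  have hn0 : 0 < n := by
    have : (1 : ℝ) ≤ n := (le_max_left _ _).trans hn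
    exact_mod_cast this
  have hn' : (n : ℝ) ≠ 0 := by positivity
  have hMn : (2 + 2 * ‖b‖) ^ 2 ≤ n * (η ^ 2 / 2) :=
    (div_le_iff₀ hη2).mp ((le_max_right _ _).trans hn)
  have hee : ∀ t, ‖e t * star (e t)‖ ≤ 1 := fun t => by
    rw [CStarRing.norm_self_mul_star]
    exact mul_le_one₀ (he1 t) (norm_nonneg _) (he1 t)
  have hpM : ∀ t, ‖p t‖ ≤ 2 + 2 * ‖b‖ := fun t => by
    linarith [norm_sub_le (e t) (e t * star (e t)), he1 t, hee t, norm_nonneg b]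
  have hcM : ∀ t, ‖c t‖ ≤ 2 + 2 * ‖b‖ := fun t => by
    have h1 := (norm_mul_le b (e t)).trans (mul_le_of_le_one_right (norm_nonneg _) (he1 t))
    have h2 := (norm_mul_le (e t) b).trans (mul_le_of_le_one_left (norm_nonneg _) (he1 t))
    linarith [norm_sub_le (b * e t) (e t * b)]
  have hconst : ∀ x : X, (n : ℝ)⁻¹ • ∑ _i ∈ Finset.range n, x = x := fun x => by
    rw [Finset.sum_const, Finset.card_range, ← Nat.cast_smul_eq_nsmul ℝ, inv_smul_smul₀ hn']
  refine ⟨(n : ℝ)⁻¹ • ∑ i ∈ Finset.range n, e (t i),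
    hA.real_smul_mem _ (hA.sum_mem _ fun i => heA (t i)),
    (n : ℝ)⁻¹ • ∑ i ∈ Finset.range n, e (t i) * star (e (t i)),
    smul_nonneg (by positivity) (Finset.sum_nonneg fun i _ => mul_star_self_nonneg _),
    norm_average_le (fun i => hee (t i)) hn0, norm_average_le (fun i => he1 (t i)) hn0,
    ?_, ?_, ?_, ?_⟩
  · rw [← smul_sub, ← Finset.sum_sub_distrib]
    exact norm_average_le_of_almost_orthogonal hη.le (fun i => hpM (t i))
      (fun i j hij => (htt i j hij).1) hn0 hMn
  · rw [mul_smul_comm, smul_mul_assoc, Finset.mul_sum, Finset.sum_mul, ← smul_sub,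
      ← Finset.sum_sub_distrib]
    exact norm_average_le_of_almost_orthogonal hη.le (fun i => hcM (t i))
      (fun i j hij => (htt i j hij).2) hn0 hMn
  · rw [smul_mul_assoc, Finset.sum_mul]
    nth_rewrite 2 [← hconst d]
    rw [← smul_sub, ← Finset.sum_sub_distrib]
    exact norm_average_le (fun i => (ht i).1) hn0
  · rw [mul_smul_comm, Finset.mul_sum]
    nth_rewrite 2 [← hconst d]
    rw [← smul_sub, ← Finset.sum_sub_distrib]
    exact norm_average_le (fun i => (ht i).2) hn0

lemma exists_norm_sub_le_one_add [l.NeBot] {A : Set X} (hA : IsClosedSubalg X A)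
    (hAD : A ⊆ D) (heA : ∀ t, e t ∈ A) (he1 : ∀ t, ‖e t‖ ≤ 1) (hD : IsClosedSubalg X D)
    (hl : ∀ d ∈ D, Tendsto (fun t => e t * d) l (𝓝 d))
    (hr : ∀ d ∈ D, Tendsto (fun t => d * e t) l (𝓝 d))
    {b : X} (hb : ∀ d ∈ D, d * b ∈ D ∧ b * d ∈ D) (hbA : ∀ a ∈ A, a * b ∈ A)
    (hdist : infDist b D ≤ 1) {ε ε' : ℝ} (hε : 0 < ε) (hε' : 0 < ε') (hbε : ‖b‖ ≤ 1 + ε) :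
    ∃ j ∈ A, ‖j‖ ≤ ε ∧ ‖b - j‖ ≤ 1 + ε' := by
  set R : ℝ := 1 + ε' / 8 with hR
  set c : ℝ := (1 + ε' / 4) / R with hc
  have hR0 : 0 < R := by positivity
  obtain ⟨κ, hκ, hbound⟩ := isAlmostConvexBound_of_one_lt (X := X)
    (show 1 < c by rw [hc, one_lt_div hR0]; linarith) R hR0.le (ε' / 4) (by positivity)
  obtain ⟨d, hd, hbd⟩ := (infDist_lt_iff (x := b) ⟨0, hD.zero_mem⟩).mp
    (hdist.trans_lt (show 1 < R by linarith))
  rw [dist_eq_norm] at hbd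
  set η : ℝ := min κ (ε' / 2) / (4 * (1 + ‖b‖ + ‖d‖)) with hηdef
  have hm : 0 < min κ (ε' / 2) := by positivity
  have hη : 0 < η := by positivity
  have hηm : 4 * (1 + ‖b‖ + ‖d‖) * η = min κ (ε' / 2) := by
    rw [hηdef]; field_simp
  have hmκ := min_le_left κ (ε' / 2)
  have hmε := min_le_right κ (ε' / 2)
  obtain ⟨u, huA, f, hf, hf1, hu1, huf, hub, hud, hdu⟩ :=
    exists_almost_central_approximate_unit hA hAD heA he1 hD hl hr hb hd hη
  have hufm : ∀ x : X, ‖(u - f) * x‖ ≤ η * ‖x‖ := fun x =>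
    (norm_mul_le _ _).trans (by gcongr)
  have hmuf : ∀ x : X, ‖x * (u - f)‖ ≤ η * ‖x‖ := fun x =>
    (norm_mul_le _ _).trans (by rw [mul_comm]; gcongr)
  have hfb : ‖f * b - b * f‖ ≤ η * (1 + 2 * ‖b‖) := by
    have h : f * b - b * f = b * (u - f) - (b * u - u * b) - (u - f) * b := by noncomm_ring
    rw [h]
    linarith [norm_sub_le (b * (u - f) - (b * u - u * b)) ((u - f) * b),
      norm_sub_le (b * (u - f)) (b * u - u * b), hufm b, hmuf b]
  have hfd : ‖f * d - d‖ ≤ η * (1 + ‖d‖) := by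
    have h : f * d - d = (u * d - d) - (u - f) * d := by noncomm_ring
    rw [h]
    linarith [norm_sub_le (u * d - d) ((u - f) * d), hufm d]
  have hdf : ‖d * f - d‖ ≤ η * (1 + ‖d‖) := by
    have h : d * f - d = (d * u - d) - d * (u - f) := by noncomm_ring
    rw [h]
    linarith [norm_sub_le (d * u - d) (d * (u - f)), hmuf d]
  have hηb : 0 ≤ η * ‖b‖ := by positivity
  have hηd : 0 ≤ η * ‖d‖ := by positivity
  have hfy : ‖f * (b - d) - (b - d) * f‖ ≤ κ := by
    have h : f * (b - d) - (b - d) * f = (f * b - b * f) - (f * d - d) + (d * f - d) := by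
      noncomm_ring
    rw [h]
    linarith [norm_add_le ((f * b - b * f) - (f * d - d)) (d * f - d),
      norm_sub_le (f * b - b * f) (f * d - d)]
  set δ : ℝ := ε / (1 + ε) with hδ
  have hδ0 : 0 ≤ δ := by positivity
  have hδ1 : δ ≤ 1 := (div_le_one (by positivity)).mpr (by linarith)
  have hδb : δ * ‖b‖ ≤ ε := by
    rw [hδ, div_mul_eq_mul_div, div_le_iff₀ (by positivity)]
    gcongr
  have hδ' : (1 - δ) * (1 + ε) = 1 := by rw [hδ]; field_simp; ring
  have hz : ‖(1 - δ) • b‖ ≤ R := by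
    rw [norm_smul, Real.norm_of_nonneg (by linarith)]
    have := mul_le_mul_of_nonneg_left hbε (show 0 ≤ 1 - δ by linarith)
    linarith
  have hfz : ‖f * ((1 - δ) • b) - ((1 - δ) • b) * f‖ ≤ κ := by
    rw [mul_smul_comm, smul_mul_assoc, ← smul_sub, norm_smul, Real.norm_of_nonneg (by linarith)]
    have := mul_le_of_le_one_left (norm_nonneg (f * b - b * f)) (show 1 - δ ≤ 1 by linarith)
    linarith
  have hT := hbound f (b - d) ((1 - δ) • b) hf hf1 hbd.le hz hfy hfz
  rw [hc, div_mul_cancel₀ _ hR0.ne'] at hT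
  refine ⟨δ • (u * b), hA.real_smul_mem _ (hbA u huA), ?_, ?_⟩
  · rw [norm_smul, Real.norm_of_nonneg hδ0]
    refine le_trans ?_ hδb
    gcongr
    exact (norm_mul_le _ _).trans (mul_le_of_le_one_left (norm_nonneg _) hu1)
  · have h : b - δ • (u * b) = (b - d - f * (b - d) + f * ((1 - δ) • b)) -
        (f * d - d) - δ • ((u - f) * b) := by
      simp only [mul_smul_comm, sub_smul, one_smul, sub_mul, mul_sub, smul_sub]
      abel
    have h1 : ‖δ • ((u - f) * b)‖ ≤ η * ‖b‖ := by
      rw [norm_smul, Real.norm_of_nonneg hδ0]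
      exact (mul_le_of_le_one_left (norm_nonneg _) hδ1).trans (hufm b)
    rw [h]
    linarith [norm_sub_le ((b - d - f * (b - d) + f * ((1 - δ) • b)) - (f * d - d))
      (δ • ((u - f) * b)), norm_sub_le (b - d - f * (b - d) + f * ((1 - δ) • b)) (f * d - d)]

end ApproximateIdentity

end CStar

/-- If `D` is a closed two-sided ideal in a closed subalgebra `E` of a C*-algebra `X`, and a
closed subalgebra `B` of `E` contains a contractive approximate identity for `D`, then every
`b ∈ B` with `dist(b, D) ≤ 1` differs by an element of `D` from some `b' ∈ B` with
`‖b'‖ ≤ 1`: the quotient map `E → E/D` maps the closed unit ball of `B` onto the closed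
unit ball of the image of `B`. -/
theorem stmt3 {X : Type*} [NonUnitalCStarAlgebra X]
    (E D B : Set X)
    (hE : IsClosedSubalg X E)
    (hD : IsClosedSubalg X D) (hDE : D ⊆ E)
    (hDideal : ∀ d ∈ D, ∀ x ∈ E, d * x ∈ D ∧ x * d ∈ D)
    (hB : IsClosedSubalg X B) (hBE : B ⊆ E)
    (hcai : IsCaiFor X (B ∩ D) D) :
    ∀ b ∈ B, infDist b D ≤ 1 → ∃ b' ∈ B, ‖b'‖ ≤ 1 ∧ b - b' ∈ D := by
  let _ : PartialOrder X := CStarAlgebra.spectralOrder X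
  have _ : StarOrderedRing X := CStarAlgebra.spectralOrderedRing X
  intro b hb hdist
  obtain ⟨ι, l, e, hne, heA, he1, hl, hr⟩ := hcai
  have hA := hB.inter hD
  have hl' : ∀ d ∈ D, Tendsto (fun t => e t * d) l (𝓝 d) := fun d hd =>
    tendsto_iff_norm_sub_tendsto_zero.mpr (hl d hd)
  have hr' : ∀ d ∈ D, Tendsto (fun t => d * e t) l (𝓝 d) := fun d hd =>
    tendsto_iff_norm_sub_tendsto_zero.mpr (hr d hd)
  set ε : ℕ → ℝ := fun n => (‖b‖ + 1) / 2 / 2 ^ n with hε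
  have hε0 : ∀ n, 0 < ε n := fun n => by positivity
  have hstep : ∀ (n : ℕ) (x : {x : X // x ∈ B ∧ b - x ∈ D}), ∃ y : {x : X // x ∈ B ∧ b - x ∈ D},
      ‖x.1‖ ≤ 1 + 2 * ε n → ‖x.1 - y.1‖ ≤ 2 * ε n ∧ ‖y.1‖ ≤ 1 + 2 * ε (n + 1) := by
    rintro n ⟨x, hxB, hxD⟩
    by_cases hx : ‖x‖ ≤ 1 + 2 * ε n
    · have hxdist : infDist x D ≤ 1 := by
        refine le_of_forall_pos_lt_add fun κ hκ => ?_
        obtain ⟨d, hd, hbd⟩ := (infDist_lt_iff (x := b) ⟨0, hD.zero_mem⟩).mp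
          (hdist.trans_lt (show 1 < 1 + κ by linarith))
        refine (infDist_lt_iff ⟨0, hD.zero_mem⟩).mpr ⟨d - (b - x), hD.sub_mem hd hxD, ?_⟩
        rw [dist_eq_norm] at hbd ⊢
        rwa [show x - (d - (b - x)) = b - d by abel]
      obtain ⟨j, hj, hjε, hxj⟩ := exists_norm_sub_le_one_add hA Set.inter_subset_right heA he1 hD
        hl' hr' (fun d hd => hDideal d hd x (hBE hxB))
        (fun a ha => ⟨hB.mul_mem ha.1 hxB, (hDideal a ha.2 x (hBE hxB)).1⟩) hxdist
        (ε := 2 * ε n) (ε' := 2 * ε (n + 1)) (by linarith [hε0 n]) (by linarith [hε0 (n + 1)]) hx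
      refine ⟨⟨x - j, hB.sub_mem hxB hj.1, ?_⟩, fun _ => ⟨by simpa using hjε, hxj⟩⟩
      rw [show b - (x - j) = (b - x) + j by abel]
      exact hD.add_mem hxD hj.2
    · exact ⟨⟨x, hxB, hxD⟩, fun h => absurd h hx⟩
  choose next hnext using hstep
  let x : ℕ → {x : X // x ∈ B ∧ b - x ∈ D} := fun n =>
    Nat.rec ⟨b, hb, by simpa using hD.zero_mem⟩ next n
  have hx : ∀ n, ‖(x n).1‖ ≤ 1 + 2 * ε n := by
    intro n
    induction n with
    | zero =>
      change ‖b‖ ≤ 1 + 2 * ((‖b‖ + 1) / 2 / 2 ^ 0)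
      linarith
    | succ n ih => exact (hnext n (x n) ih).2
  have hdistx : ∀ n, dist (x n).1 (x (n + 1)).1 ≤ (2 * (‖b‖ + 1)) / 2 / 2 ^ n := fun n => by
    rw [dist_eq_norm]
    refine ((hnext n (x n) (hx n)).1).trans_eq ?_
    simp only [hε]
    ring
  obtain ⟨b', hb'⟩ := cauchySeq_tendsto_of_complete (cauchySeq_of_le_geometric_two hdistx)
  have hεlim : Tendsto (fun n => 1 + 2 * ε n) atTop (𝓝 1) := by
    have h := (tendsto_pow_atTop_nhds_zero_of_lt_one (r := (1 / 2 : ℝ)) (by norm_num)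
      (by norm_num)).const_mul (‖b‖ + 1) |>.const_add 1
    simp only [mul_zero, add_zero] at h
    refine h.congr fun n => ?_
    simp only [hε, one_div, inv_pow]
    ring
  exact ⟨b', hB.isClosed.mem_of_tendsto hb' (Eventually.of_forall fun n => (x n).2.1),
    le_of_tendsto_of_tendsto' hb'.norm hεlim hx,
    hD.isClosed.mem_of_tendsto (hb'.const_sub b) (Eventually.of_forall fun n => (x n).2.2)⟩
end

section
/- Let X₁ and X₂ be C*-algebras, B₁ ⊆ X₁ and B₂ ⊆ X₂ norm-closed subalgebras, and A₁, A₂ norm-closed two-sided ideals of B₁ and B₂ respectively, each admitting a contractive approximate identity. Let ρ : B₁ → B₂ be a ℂ-linear multiplicative map with ‖ρ(b)‖ ≤ ‖b‖ for all b ∈ B₁ and ρ(A₁) ⊆ A₂. Assume: (a) for every a₂ ∈ A₂ and ε > 0 there exists a₁ ∈ A₁ with ρ(a₁) = a₂ and ‖a₁‖ ≤ ‖a₂‖ + ε; and (b) for every b₂ ∈ B₂ and ε > 0 there exists b₁ ∈ B₁ with ρ(b₁) − b₂ ∈ A₂ and dist(b₁, A₁) ≤ dist(b₂, A₂) + ε.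 Then for every b₂ ∈ B₂ and ε > 0 there exists b₁ ∈ B₁ with ρ(b₁) = b₂ and ‖b₁‖ ≤ ‖b₂‖ + ε; in particular ρ is surjective and is a metric quotient map. (Five lemma variant: if the two outer vertical maps in a morphism of extensions are quotient maps, so is the middle one.) -/
open Filter Topology Metric

/-- The operator Cauchy-Schwarz inequality for a row, a diagonal and a column. -/
theorem norm_mul_mul_add_mul_mul_le {A : Type*} [NonUnitalCStarAlgebra A]
    {r₁ r₂ s₁ s₂ a c : A} {m t : ℝ} (ha : ‖a‖ ≤ t) (hc : ‖c‖ ≤ t)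
    (hr : ‖r₁ * star r₁ + r₂ * star r₂‖ ≤ m) (hs : ‖star s₁ * s₁ + star s₂ * s₂‖ ≤ m) :
    ‖r₁ * a * s₁ + r₂ * c * s₂‖ ≤ m * t := by
  let _ := CStarAlgebra.spectralOrder A
  have := CStarAlgebra.spectralOrderedRing A
  have ht : 0 ≤ t := (norm_nonneg a).trans ha
  have hm : 0 ≤ m := (norm_nonneg _).trans hr
  let x : WithCStarModule A (A × A) := (WithCStarModule.equiv A (A × A)).symm (star s₁, star s₂)
  let y : WithCStarModule A (A × A) := (WithCStarModule.equiv A (A × A)).symm (r₁ * a, r₂ * c)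
  have hx : ‖x‖ ^ 2 ≤ m := by
    rw [WithCStarModule.prod_norm_sq]
    simpa [x, WithCStarModule.inner_def] using hs
  have conj_le : ∀ r d : A, ‖d‖ ≤ t → r * d * star (r * d) ≤ t ^ 2 • (r * star r) := by
    intro r d hd
    have h := CStarAlgebra.star_right_conjugate_le_norm_smul (a := r) (b := d * star d)
      (IsSelfAdjoint.mul_star_self d)
    have h' : ‖d * star d‖ • (r * star r) ≤ t ^ 2 • (r * star r) := by
      refine smul_le_smul_of_nonneg_right ?_ (mul_star_self_nonneg r)
      rw [CStarRing.norm_self_mul_star, sq]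
      gcongr
    simpa [mul_assoc] using h.trans h'
  have hy : ‖y‖ ^ 2 ≤ t ^ 2 * m := by
    rw [WithCStarModule.prod_norm_sq]
    have h : r₁ * a * star (r₁ * a) + r₂ * c * star (r₂ * c)
        ≤ t ^ 2 • (r₁ * star r₁ + r₂ * star r₂) := by
      rw [smul_add]
      exact add_le_add (conj_le _ _ ha) (conj_le _ _ hc)
    have h₁ := CStarAlgebra.norm_le_norm_of_nonneg_of_le
      (add_nonneg (mul_star_self_nonneg _) (mul_star_self_nonneg _)) h
    rw [norm_smul, Real.norm_of_nonneg (by positivity)] at h₁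
    have h₂ := h₁.trans (mul_le_mul_of_nonneg_left hr (by positivity))
    simpa [y, WithCStarModule.inner_def] using h₂
  have hxy := CStarModule.norm_inner_le (A := A) (WithCStarModule A (A × A)) (x := x) (y := y)
  have hin : inner A x y = r₁ * a * s₁ + r₂ * c * s₂ := by
    simp [x, y, WithCStarModule.prod_inner, WithCStarModule.inner_def]
  rw [hin] at hxy
  refine hxy.trans (abs_le_of_sq_le_sq ?_ (by positivity) |> (le_abs_self _).trans)
  calc (‖x‖ * ‖y‖) ^ 2 = ‖x‖ ^ 2 * ‖y‖ ^ 2 := by ring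
    _ ≤ m * (t ^ 2 * m) := by gcongr
    _ = (m * t) ^ 2 := by ring

/-- A contraction almost fixing `x` has an adjoint almost fixing `x`. -/
theorem norm_star_mul_sub_sq_le {A : Type*} [NonUnitalCStarAlgebra A] {e x : A}
    (he : ‖e‖ ≤ 1) : ‖star e * x - x‖ ^ 2 ≤ 2 * ‖x‖ * ‖e * x - x‖ := by
  let _ := CStarAlgebra.spectralOrder A
  have := CStarAlgebra.spectralOrderedRing A
  set d := e * x - x with hd
  have hle : star (star e * x - x) * (star e * x - x) ≤ -(star x * d + star d * x) := by
    have h := CStarAlgebra.star_left_conjugate_le_norm_smul (a := x) (b := e * star e)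
      (IsSelfAdjoint.mul_star_self e)
    have h' : ‖e * star e‖ • (star x * x) ≤ (1 : ℝ) • (star x * x) := by
      refine smul_le_smul_of_nonneg_right ?_ (star_mul_self_nonneg x)
      rw [CStarRing.norm_self_mul_star]
      exact mul_le_one₀ he (norm_nonneg _) he
    have h₂ := sub_nonneg.2 (h.trans h')
    rw [← sub_nonneg]
    convert h₂ using 1
    simp only [hd, star_sub, star_mul, star_star, one_smul]
    noncomm_ring
  have h := CStarAlgebra.norm_le_norm_of_nonneg_of_le (star_mul_self_nonneg _) hle
  rw [CStarRing.norm_star_mul_self, norm_neg] at h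
  calc ‖star e * x - x‖ ^ 2 = _ := sq _
    _ ≤ _ := h
    _ ≤ ‖star x‖ * ‖d‖ + ‖star d‖ * ‖x‖ :=
      (norm_add_le _ _).trans (add_le_add (norm_mul_le _ _) (norm_mul_le _ _))
    _ = 2 * ‖x‖ * ‖d‖ := by simp only [norm_star]; ring

/-- Increments of cosine and sine on a uniform partition of `[0, π / 2]`, used as weights. -/
theorem exists_weights {n : ℕ} (hn : 0 < n) : ∃ g m : ℕ → ℝ,
    (∀ i, |g i| ≤ 2 / n) ∧ (∀ i, |m i| ≤ 2 / n) ∧ ∑ i ∈ Finset.range n, m i = 1 ∧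
    ∀ i < n, |∑ j ∈ Finset.Ico (i + 1) n, (g i * g j + m i * m j) - m i| ≤ 4 / (n : ℝ) ^ 2 := by
  have hn' : (0 : ℝ) < n := by exact_mod_cast hn
  set θ : ℝ := Real.pi / 2 / n with hθ
  have hθn : θ * n = Real.pi / 2 := by rw [hθ]; field_simp
  have hθle : |θ| ≤ 2 / n := by
    rw [abs_of_nonneg (by positivity), hθ]
    gcongr
    linarith [Real.pi_le_four]
  have hg : ∀ i : ℕ, |Real.cos (θ * i) - Real.cos (θ * ((i + 1 : ℕ) : ℝ))| ≤ 2 / n := by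
    intro i
    have h := Real.abs_cos_sub_cos_le (θ * i) (θ * ((i + 1 : ℕ) : ℝ))
    have : θ * i - θ * ((i + 1 : ℕ) : ℝ) = -θ := by push_cast; ring
    rw [this, abs_neg] at h
    exact h.trans hθle
  have hm : ∀ i : ℕ, |Real.sin (θ * ((i + 1 : ℕ) : ℝ)) - Real.sin (θ * i)| ≤ 2 / n := by
    intro i
    have h := Real.abs_sin_sub_sin_le (θ * ((i + 1 : ℕ) : ℝ)) (θ * i)
    have : θ * ((i + 1 : ℕ) : ℝ) - θ * i = θ := by push_cast; ring
    rw [this] at h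
    exact h.trans hθle
  refine ⟨fun i => Real.cos (θ * i) - Real.cos (θ * ((i + 1 : ℕ) : ℝ)),
    fun i => Real.sin (θ * ((i + 1 : ℕ) : ℝ)) - Real.sin (θ * i), hg, hm, ?_, ?_⟩
  · rw [Finset.sum_range_sub (fun i : ℕ => Real.sin (θ * i)), hθn]
    simp
  · intro i hi
    have hsg : ∑ j ∈ Finset.Ico (i + 1) n,
        (Real.cos (θ * j) - Real.cos (θ * ((j + 1 : ℕ) : ℝ))) =
          Real.cos (θ * ((i + 1 : ℕ) : ℝ)) := by
      have h := Finset.sum_Ico_sub (fun j : ℕ => -Real.cos (θ * j)) (Nat.succ_le_of_lt hi)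
      simp only [neg_sub_neg, hθn, Real.cos_pi_div_two] at h
      simpa using h
    have hsm : ∑ j ∈ Finset.Ico (i + 1) n,
        (Real.sin (θ * ((j + 1 : ℕ) : ℝ)) - Real.sin (θ * j)) =
          1 - Real.sin (θ * ((i + 1 : ℕ) : ℝ)) := by
      have h := Finset.sum_Ico_sub (fun j : ℕ => Real.sin (θ * j)) (Nat.succ_le_of_lt hi)
      simpa only [hθn, Real.sin_pi_div_two] using h
    rw [Finset.sum_add_distrib, ← Finset.mul_sum, ← Finset.mul_sum, hsg, hsm]
    have h₁ := sq_le_sq' (abs_le.1 (hg i)).1 (abs_le.1 (hg i)).2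
    have h₂ := sq_le_sq' (abs_le.1 (hm i)).1 (abs_le.1 (hm i)).2
    have h₃ : (2 / (n : ℝ)) ^ 2 = 4 / (n : ℝ) ^ 2 := by ring
    have h₄ := Real.sin_sq_add_cos_sq (θ * i)
    have h₅ := Real.sin_sq_add_cos_sq (θ * ((i + 1 : ℕ) : ℝ))
    rw [h₃] at h₁ h₂
    rw [abs_le]
    constructor <;> nlinarith

theorem norm_sum_sum_sub_le {V : Type*} [NormedAddCommGroup V] [NormedSpace ℝ V]
    {n : ℕ} (hn : 0 < n) {g m : ℕ → ℝ} (hg : ∀ i, |g i| ≤ 2 / n) (hm : ∀ i, |m i| ≤ 2 / n)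
    (hgm : ∀ i < n, |∑ j ∈ Finset.Ico (i + 1) n, (g i * g j + m i * m j) - m i|
      ≤ 4 / (n : ℝ) ^ 2)
    {E : ℕ → ℕ → V} {L R : ℕ → V} {η C : ℝ} (hη : 0 ≤ η)
    (hE : ∀ i, ‖E i i‖ ≤ C) (hL : ∀ i, ‖L i‖ ≤ C) (hR : ∀ i, ‖R i‖ ≤ C)
    (hEL : ∀ i j, i < j → ‖E i j - L i‖ ≤ η) (hER : ∀ i j, j < i → ‖E i j - R j‖ ≤ η) :
    ‖∑ i ∈ Finset.range n, ∑ j ∈ Finset.range n, (g i * g j + m i * m j) • E i j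
      - ∑ i ∈ Finset.range n, m i • (L i + R i)‖ ≤ 8 * η + 16 * C / n := by
  have hn' : (0 : ℝ) < n := by exact_mod_cast hn
  have hC : 0 ≤ C := (norm_nonneg _).trans (hL 0)
  set w : ℕ → ℕ → ℝ := fun i j => g i * g j + m i * m j with hw
  have hwsymm : ∀ i j, w i j = w j i := fun i j => by simp only [hw]; ring
  have hwle : ∀ i j, |w i j| ≤ 8 / (n : ℝ) ^ 2 := by
    intro i j
    calc |w i j| ≤ |g i * g j| + |m i * m j| := abs_add_le _ _
      _ = |g i| * |g j| + |m i| * |m j| := by rw [abs_mul, abs_mul]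
      _ ≤ 2 / n * (2 / n) + 2 / n * (2 / n) := by gcongr <;> apply_assumption
      _ = 8 / (n : ℝ) ^ 2 := by ring
  set F : ℕ → ℕ → V := fun i j => (if i < j then L i else 0) + (if j < i then R j else 0) with hF
  have hEF : ∀ i j, ‖E i j - F i j‖ ≤ η + if i = j then C else 0 := by
    intro i j
    rcases lt_trichotomy i j with h | rfl | h
    · simpa [hF, h, h.ne, h.le, h.not_gt] using hEL i j h
    · simpa [hF] using (hE i).trans (by linarith)
    · simpa [hF, h, h.ne', h.le, h.not_gt] using hER i j h
  have hfilter : ∀ i, (Finset.range n).filter (fun j => i < j) = Finset.Ico (i + 1) n := by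
    intro i; ext j; simp only [Finset.mem_filter, Finset.mem_range, Finset.mem_Ico]; omega
  have hwF : ∑ i ∈ Finset.range n, ∑ j ∈ Finset.range n, w i j • F i j =
      ∑ i ∈ Finset.range n, (∑ j ∈ Finset.Ico (i + 1) n, w i j) • (L i + R i) := by
    simp only [hF, smul_add, Finset.sum_add_distrib, smul_ite, smul_zero]
    congr 1
    · refine Finset.sum_congr rfl fun i _ => ?_
      rw [← Finset.sum_filter, hfilter, Finset.sum_smul]
    · rw [Finset.sum_comm]
      refine Finset.sum_congr rfl fun i _ => ?_
      rw [← Finset.sum_filter, hfilter, Finset.sum_smul]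
      exact Finset.sum_congr rfl fun j _ => by rw [hwsymm]
  have h₁ : ‖∑ i ∈ Finset.range n, ∑ j ∈ Finset.range n, w i j • (E i j - F i j)‖
      ≤ 8 * η + 8 * C / n := by
    calc _ ≤ ∑ i ∈ Finset.range n, ∑ j ∈ Finset.range n,
            8 / (n : ℝ) ^ 2 * (η + if i = j then C else 0) := by
          refine norm_sum_le_of_le _ fun i _ => norm_sum_le_of_le _ fun j _ => ?_
          rw [norm_smul, Real.norm_eq_abs]
          exact mul_le_mul (hwle i j) (hEF i j) (norm_nonneg _) (by positivity)
      _ = ∑ i ∈ Finset.range n, 8 / (n : ℝ) ^ 2 * (n * η + C) := by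
          refine Finset.sum_congr rfl fun i hi => ?_
          rw [← Finset.mul_sum, Finset.sum_add_distrib, Finset.sum_ite_eq, if_pos hi]
          simp
      _ = 8 * η + 8 * C / n := by
          rw [Finset.sum_const, Finset.card_range, nsmul_eq_mul]
          field_simp
  have h₂ : ‖∑ i ∈ Finset.range n,
      (∑ j ∈ Finset.Ico (i + 1) n, w i j - m i) • (L i + R i)‖ ≤ 8 * C / n := by
    calc _ ≤ ∑ i ∈ Finset.range n, 4 / (n : ℝ) ^ 2 * (C + C) := by
          refine norm_sum_le_of_le _ fun i hi => ?_
          rw [norm_smul, Real.norm_eq_abs]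
          exact mul_le_mul (hgm i (Finset.mem_range.1 hi))
            ((norm_add_le _ _).trans (add_le_add (hL i) (hR i))) (norm_nonneg _) (by positivity)
      _ = 8 * C / n := by
          rw [Finset.sum_const, Finset.card_range, nsmul_eq_mul]
          field_simp
          ring
  have h₃ : ∑ i ∈ Finset.range n, ∑ j ∈ Finset.range n, w i j • E i j
      - ∑ i ∈ Finset.range n, m i • (L i + R i) =
      ∑ i ∈ Finset.range n, ∑ j ∈ Finset.range n, w i j • (E i j - F i j) +
      ∑ i ∈ Finset.range n, (∑ j ∈ Finset.Ico (i + 1) n, w i j - m i) • (L i + R i) := by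
    simp only [smul_sub, sub_smul, Finset.sum_sub_distrib, hwF]
    abel
  rw [h₃]
  refine (norm_add_le _ _).trans ((add_le_add h₁ h₂).trans_eq ?_)
  ring

theorem norm_sum_mul_sum_sub_le {A : Type*} [NonUnitalNormedRing A] [NormedSpace ℝ A]
    [IsScalarTower ℝ A A] [SMulCommClass ℝ A A]
    {n : ℕ} (hn : 0 < n) {g m : ℕ → ℝ} (hg : ∀ i, |g i| ≤ 2 / n) (hm : ∀ i, |m i| ≤ 2 / n)
    (hgm : ∀ i < n, |∑ j ∈ Finset.Ico (i + 1) n, (g i * g j + m i * m j) - m i|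
      ≤ 4 / (n : ℝ) ^ 2)
    {P Q L R : ℕ → A} {η C : ℝ} (hη : 0 ≤ η)
    (hP : ∀ i, ‖P i‖ ≤ C) (hQ : ∀ i, ‖Q i‖ ≤ 1) (hL : ∀ i, ‖L i‖ ≤ C) (hR : ∀ i, ‖R i‖ ≤ C)
    (hPL : ∀ i j, i < j → ‖P i * Q j - L i‖ ≤ η) (hPR : ∀ i j, j < i → ‖P i * Q j - R j‖ ≤ η) :
    ‖(∑ i ∈ Finset.range n, g i • P i) * (∑ i ∈ Finset.range n, g i • Q i)
      + (∑ i ∈ Finset.range n, m i • P i) * (∑ i ∈ Finset.range n, m i • Q i)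
      - ∑ i ∈ Finset.range n, m i • (L i + R i)‖ ≤ 8 * η + 16 * C / n := by
  have hC : 0 ≤ C := (norm_nonneg _).trans (hL 0)
  have h := norm_sum_sum_sub_le hn hg hm hgm (E := fun i j => P i * Q j) hη
    (fun i => (norm_mul_le _ _).trans
      ((mul_le_mul (hP i) (hQ i) (norm_nonneg _) hC).trans_eq (mul_one C))) hL hR hPL hPR
  convert h using 2
  congr 1
  simp only [Finset.sum_mul_sum, smul_mul_smul_comm, add_smul, Finset.sum_add_distrib]

theorem norm_sum_smul_le {V : Type*} [NormedAddCommGroup V] [NormedSpace ℝ V]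
    {n : ℕ} (hn : 0 < n) {g : ℕ → ℝ} (hg : ∀ i, |g i| ≤ 2 / n) {v : ℕ → V} {C : ℝ}
    (hv : ∀ i < n, ‖v i‖ ≤ C) : ‖∑ i ∈ Finset.range n, g i • v i‖ ≤ 2 * C := by
  have hn' : (0 : ℝ) < n := by exact_mod_cast hn
  calc _ ≤ ∑ i ∈ Finset.range n, 2 / (n : ℝ) * C := by
        refine norm_sum_le_of_le _ fun i hi => ?_
        rw [norm_smul, Real.norm_eq_abs]
        exact mul_le_mul (hg i) (hv i (Finset.mem_range.1 hi)) (norm_nonneg _) (by positivity)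
    _ = 2 * C := by
        rw [Finset.sum_const, Finset.card_range, nsmul_eq_mul]
        field_simp

theorem norm_conjugate_add_conjugate_one_sub_le {A : Type*} [NonUnitalCStarAlgebra A]
    {G M a c : A} {δ t : ℝ} (ha : ‖a‖ ≤ t) (hc : ‖c‖ ≤ t)
    (hr : ‖G * star G + M * star M - (M + star M)‖ ≤ δ)
    (hs : ‖star G * G + star M * M - (star M + M)‖ ≤ δ) :
    ‖G * a * G + (c - M * c - c * M + M * c * M)‖ ≤ (1 + δ) * t := by
  have key := norm_mul_mul_add_mul_mul_le (A := Unitization ℂ A) (r₁ := (G : Unitization ℂ A))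
    (s₁ := (G : Unitization ℂ A)) (r₂ := 1 - (M : Unitization ℂ A))
    (s₂ := 1 - (M : Unitization ℂ A)) (a := (a : Unitization ℂ A)) (c := (c : Unitization ℂ A))
    (m := 1 + δ) (t := t) (by rwa [Unitization.norm_inr]) (by rwa [Unitization.norm_inr]) ?_ ?_
  · rw [← Unitization.norm_inr (𝕜 := ℂ)]
    convert key using 1
    congr 1
    simp only [Unitization.inr_add, Unitization.inr_sub, Unitization.inr_mul]
    noncomm_ring
  · have h : (G : Unitization ℂ A) * star (G : Unitization ℂ A)
        + (1 - (M : Unitization ℂ A)) * star (1 - (M : Unitization ℂ A)) =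
        1 + ((G * star G + M * star M - (M + star M) : A) : Unitization ℂ A) := by
      simp only [Unitization.inr_add, Unitization.inr_sub, Unitization.inr_mul,
        Unitization.inr_star, star_sub, star_one]
      noncomm_ring
    rw [h]
    refine (norm_add_le _ _).trans (add_le_add CStarRing.norm_one.le ?_)
    rwa [Unitization.norm_inr]
  · have h : star (G : Unitization ℂ A) * (G : Unitization ℂ A)
        + star (1 - (M : Unitization ℂ A)) * (1 - (M : Unitization ℂ A)) =
        1 + ((star G * G + star M * M - (star M + M) : A) : Unitization ℂ A) := by
      simp only [Unitization.inr_add, Unitization.inr_sub, Unitization.inr_mul,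
        Unitization.inr_star, star_sub, star_one]
      noncomm_ring
    rw [h]
    refine (norm_add_le _ _).trans (add_le_add CStarRing.norm_one.le ?_)
    rwa [Unitization.norm_inr]

/-- Averaging a nested sequence of contractions `e i` gives an element `G` for which the
correction of `b` by `G * (a - b * e n) * G` is almost as small as `a` and `b - a₀`. -/
theorem exists_norm_add_conjugate_le {A : Type*} [NonUnitalCStarAlgebra A]
    {n : ℕ} (hn : 0 < n) {σ : ℝ} (hσ : 0 < σ) (hσ1 : σ ≤ 1) (hnσ : 1 / (n : ℝ) ≤ σ)
    {e : ℕ → A} {b a₀ : A} (he : ∀ i, ‖e i‖ ≤ 1)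
    (heₗ : ∀ i j, i < j → ‖e j * e i - e i‖ ≤ σ ^ 2 / 2)
    (heᵣ : ∀ i j, i < j → ‖e i * e j - e i‖ ≤ σ ^ 2 / 2)
    (hbₗ : ∀ i j, i < j → ‖e j * (b * e i) - b * e i‖ ≤ σ ^ 2 / 2)
    (hbᵣ : ∀ i j, i < j → ‖e i * b * e j - e i * b‖ ≤ σ ^ 2 / 2)
    (ha₀ : ∀ i, ‖e i * a₀ - a₀‖ ≤ σ ^ 2 / 2) :
    ∃ g : ℕ → ℝ, ∀ (a : A) (t : ℝ), ‖a‖ ≤ t → ‖b - a₀‖ ≤ t →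
      ‖b + (∑ i ∈ Finset.range n, g i • e i) * (a - b * e n) * (∑ i ∈ Finset.range n, g i • e i)‖
        ≤ t + ((24 + 16 * ‖b‖) * (t + 1) + 4 * ‖b‖ + 6) * σ := by
  obtain ⟨g, m, hg, hm, hm1, hgm⟩ := exists_weights hn
  have hησ : σ ^ 2 / 2 ≤ σ := by nlinarith
  have hb0 := norm_nonneg b
  refine ⟨g, fun a t ha hc => ?_⟩
  set G := ∑ i ∈ Finset.range n, g i • e i with hG
  set M := ∑ i ∈ Finset.range n, m i • e i with hM
  have hGs : star G = ∑ i ∈ Finset.range n, g i • star (e i) := by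
    simp [hG, star_sum, star_smul]
  have hMs : star M = ∑ i ∈ Finset.range n, m i • star (e i) := by
    simp [hM, star_sum, star_smul]
  have he' : ∀ i, ‖star (e i)‖ ≤ 1 := fun i => (norm_star _).trans_le (he i)
  have hstar : ∀ {u x : A}, ‖u‖ ≤ 1 → ‖x‖ ≤ 1 → ‖u * x - x‖ ≤ σ ^ 2 / 2 →
      ‖star u * x - x‖ ≤ σ := by
    intro u x hu hx hux
    refine abs_le_of_sq_le_sq ?_ hσ.le |> (le_abs_self _).trans
    refine (norm_star_mul_sub_sq_le hu).trans ?_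
    calc 2 * ‖x‖ * ‖u * x - x‖ ≤ 2 * 1 * (σ ^ 2 / 2) := by gcongr
      _ = σ ^ 2 := by ring
  have hsl : ∀ i j, i < j → ‖star (e j) * e i - e i‖ ≤ σ := fun i j hij =>
    hstar (he j) (he i) (heₗ i j hij)
  have hsl' : ∀ i j, i < j → ‖star (e i) * e j - star (e i)‖ ≤ σ := fun i j hij => by
    rw [← norm_star]; simpa using hsl i j hij
  have hsr : ∀ i j, i < j → ‖e j * star (e i) - star (e i)‖ ≤ σ := fun i j hij => by
    have h := hstar (u := star (e j)) (x := star (e i)) (he' j) (he' i)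
      (by rw [← norm_star]; simpa using heᵣ i j hij)
    simpa using h
  have hsr' : ∀ i j, i < j → ‖e i * star (e j) - e i‖ ≤ σ := fun i j hij => by
    rw [← norm_star]; simpa using hsr i j hij
  set D := (24 + 16 * ‖b‖) * σ with hD
  have hdiv : ∀ C, 0 ≤ C → 16 * C / (n : ℝ) ≤ 16 * C * σ := fun C hC => by
    rw [div_eq_mul_one_div]
    gcongr
  have h₁ : ‖G * star G + M * star M - (M + star M)‖ ≤ D := by
    have h := norm_sum_mul_sum_sub_le hn hg hm hgm (P := e) (Q := fun i => star (e i))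
      (L := e) (R := fun i => star (e i)) hσ.le he he' he he' hsr' (fun i j hij => hsr j i hij)
    simp only [smul_add, Finset.sum_add_distrib] at h
    rw [← hGs, ← hMs] at h
    have := hdiv 1 zero_le_one
    refine h.trans ?_
    rw [hD]; nlinarith
  have h₂ : ‖star G * G + star M * M - (star M + M)‖ ≤ D := by
    have h := norm_sum_mul_sum_sub_le hn hg hm hgm (P := fun i => star (e i)) (Q := e)
      (L := fun i => star (e i)) (R := e) hσ.le he' he he' he hsl' (fun i j hij => hsl j i hij)
    simp only [smul_add, Finset.sum_add_distrib] at h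
    rw [← hGs, ← hMs] at h
    have := hdiv 1 zero_le_one
    refine h.trans ?_
    rw [hD]; nlinarith
  have heb : ∀ i, ‖e i * b‖ ≤ ‖b‖ := fun i => (norm_mul_le _ _).trans
    (mul_le_of_le_one_left hb0 (he i))
  have hbe : ∀ i, ‖b * e i‖ ≤ ‖b‖ := fun i => (norm_mul_le _ _).trans
    (mul_le_of_le_one_right hb0 (he i))
  have h₃ : ‖G * b * G + M * b * M - (M * b + b * M)‖ ≤ D := by
    have h := norm_sum_mul_sum_sub_le hn hg hm hgm (P := fun i => e i * b) (Q := e)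
      (L := fun i => e i * b) (R := fun i => b * e i) hσ.le heb he heb hbe
      (fun i j hij => (hbᵣ i j hij).trans hησ)
      (fun i j hij => by rw [mul_assoc]; exact (hbₗ j i hij).trans hησ)
    simp only [smul_add, Finset.sum_add_distrib] at h
    rw [show ∑ i ∈ Finset.range n, m i • (b * e i) = b * M by
        simp only [hM, Finset.mul_sum, mul_smul_comm]] at h
    simp only [← smul_mul_assoc, ← Finset.sum_mul] at h
    have := hdiv ‖b‖ hb0
    refine h.trans ?_
    rw [hD]; nlinarith
  have hGn : ‖G‖ ≤ 2 := (norm_sum_smul_le hn hg fun i _ => he i).trans_eq (mul_one 2)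
  have hMn : ‖M‖ ≤ 2 := (norm_sum_smul_le hn hm fun i _ => he i).trans_eq (mul_one 2)
  have h₄ : ‖e n * G - G‖ ≤ 2 * σ := by
    have h : e n * G - G = ∑ i ∈ Finset.range n, g i • (e n * e i - e i) := by
      simp only [hG, Finset.mul_sum, mul_smul_comm, smul_sub, Finset.sum_sub_distrib]
    rw [h]
    exact norm_sum_smul_le hn hg fun i hi => (heₗ i n hi).trans hησ
  have h₅ : ‖M * a₀ - a₀‖ ≤ 2 * σ := by
    have h : M * a₀ - a₀ = ∑ i ∈ Finset.range n, m i • (e i * a₀ - a₀) := by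
      simp only [hM, Finset.sum_mul, smul_mul_assoc, smul_sub, Finset.sum_sub_distrib,
        ← Finset.sum_smul, hm1, one_smul]
    rw [h]
    exact norm_sum_smul_le hn hm fun i _ => (ha₀ i).trans hησ
  have hmain := norm_conjugate_add_conjugate_one_sub_le ha hc h₁ h₂
  have hsplit : b + G * (a - b * e n) * G =
      (G * a * G + ((b - a₀) - M * (b - a₀) - (b - a₀) * M + M * (b - a₀) * M))
      - (G * b * G + M * b * M - (M * b + b * M)) - G * b * (e n * G - G)
      + ((M * a₀ - a₀) * M - (M * a₀ - a₀)) := by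
    noncomm_ring
  have h₆ : ‖G * b * (e n * G - G)‖ ≤ 4 * ‖b‖ * σ := by
    calc _ ≤ ‖G‖ * ‖b‖ * ‖e n * G - G‖ :=
          (norm_mul_le _ _).trans (mul_le_mul_of_nonneg_right (norm_mul_le _ _) (norm_nonneg _))
      _ ≤ 2 * ‖b‖ * (2 * σ) := by gcongr
      _ = 4 * ‖b‖ * σ := by ring
  have h₇ : ‖(M * a₀ - a₀) * M - (M * a₀ - a₀)‖ ≤ 6 * σ := by
    calc _ ≤ ‖M * a₀ - a₀‖ * ‖M‖ + ‖M * a₀ - a₀‖ :=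
          (norm_sub_le _ _).trans (add_le_add (norm_mul_le _ _) le_rfl)
      _ ≤ 2 * σ * 2 + 2 * σ := by gcongr
      _ = 6 * σ := by ring
  rw [hsplit]
  refine (norm_add_le _ _).trans ?_
  refine (add_le_add ((norm_sub_le _ _).trans
    (add_le_add ((norm_sub_le _ _).trans (add_le_add hmain h₃)) h₆)) h₇).trans_eq ?_
  rw [hD]; ring

/-- Five lemma, quotient map case: given a morphism `ρ : B₁ → B₂` between closed subalgebras
of C*-algebras (a contractive ℂ-linear multiplicative map, encoded as a map `X₁ → X₂` whose
behaviour matters only on `B₁`), carrying the approximately unital closed two-sided ideal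
`A₁` of `B₁` into the corresponding ideal `A₂` of `B₂`, if (a) `ρ` restricted to `A₁` is a
metric quotient map onto `A₂`, and (b) the induced map `B₁/A₁ → B₂/A₂` is a metric quotient
map, then `ρ` is a metric quotient map of `B₁` onto `B₂`. -/
theorem stmt11 {X₁ X₂ : Type*} [NonUnitalCStarAlgebra X₁] [NonUnitalCStarAlgebra X₂]
    (B₁ A₁ : Set X₁) (B₂ A₂ : Set X₂)
    (hB₁ : IsClosedSubalg X₁ B₁) (hB₂ : IsClosedSubalg X₂ B₂)
    (hA₁ : IsClosedSubalg X₁ A₁) (hA₁B : A₁ ⊆ B₁)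
    (hA₁ideal : ∀ a ∈ A₁, ∀ b ∈ B₁, a * b ∈ A₁ ∧ b * a ∈ A₁)
    (hcai₁ : IsCaiFor X₁ A₁ A₁)
    (hA₂ : IsClosedSubalg X₂ A₂) (hA₂B : A₂ ⊆ B₂)
    (hA₂ideal : ∀ a ∈ A₂, ∀ b ∈ B₂, a * b ∈ A₂ ∧ b * a ∈ A₂)
    (hcai₂ : IsCaiFor X₂ A₂ A₂)
    (ρ : X₁ → X₂)
    (hmap : ∀ b ∈ B₁, ρ b ∈ B₂)
    (hadd : ∀ x ∈ B₁, ∀ y ∈ B₁, ρ (x + y) = ρ x + ρ y)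
    (hsmul : ∀ (c : ℂ), ∀ x ∈ B₁, ρ (c • x) = c • ρ x)
    (hmul : ∀ x ∈ B₁, ∀ y ∈ B₁, ρ (x * y) = ρ x * ρ y)
    (hcontr : ∀ b ∈ B₁, ‖ρ b‖ ≤ ‖b‖)
    (hAmap : ∀ a ∈ A₁, ρ a ∈ A₂)
    (hAquot : ∀ a₂ ∈ A₂, ∀ ε > (0 : ℝ), ∃ a₁ ∈ A₁, ρ a₁ = a₂ ∧ ‖a₁‖ ≤ ‖a₂‖ + ε)
    (hQquot : ∀ b₂ ∈ B₂, ∀ ε > (0 : ℝ), ∃ b₁ ∈ B₁,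
        ρ b₁ - b₂ ∈ A₂ ∧ infDist b₁ A₁ ≤ infDist b₂ A₂ + ε) :
    ∀ b₂ ∈ B₂, ∀ ε > (0 : ℝ), ∃ b₁ ∈ B₁, ρ b₁ = b₂ ∧ ‖b₁‖ ≤ ‖b₂‖ + ε := by
  intro b₂ hb₂ ε hε
  have hsubA : ∀ {x y : X₁}, x ∈ A₁ → y ∈ A₁ → x - y ∈ A₁ := fun {x y} hx hy => by
    simpa [sub_eq_add_neg] using hA₁.add_mem hx (hA₁.smul_mem (-1) hy)
  have hρsub : ∀ x ∈ B₁, ∀ y ∈ B₁, ρ (x - y) = ρ x - ρ y := fun x hx y hy => by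
    have h := hadd x hx _ (hB₁.smul_mem (-1) hy)
    rw [hsmul _ _ hy] at h
    simpa [sub_eq_add_neg] using h
  have hd : infDist b₂ A₂ ≤ ‖b₂‖ := by
    simpa using infDist_le_dist_of_mem (x := b₂) hA₂.zero_mem
  set t : ℝ := ‖b₂‖ + ε / 2 with ht
  have ht0 : 0 ≤ t := by positivity
  obtain ⟨b', hb', hb'A, hb'd⟩ := hQquot b₂ hb₂ (ε / 4) (by positivity)
  obtain ⟨x', hx', hx'd⟩ := (infDist_lt_iff (x := b') (r := t) ⟨0, hA₁.zero_mem⟩).1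
    (by rw [ht]; linarith)
  obtain ⟨a', ha', ha'ρ, -⟩ := hAquot _ hb'A 1 one_pos
  set b := b' - a' with hb
  set a₀ := x' - a' with ha₀
  have hbB : b ∈ B₁ := by
    simpa [hb, sub_eq_add_neg] using hB₁.add_mem hb' (hB₁.smul_mem (-1) (hA₁B ha'))
  have hbρ : ρ b = b₂ := by
    rw [hb, hρsub _ hb' _ (hA₁B ha'), ha'ρ, sub_sub_cancel]
  have ha₀A : a₀ ∈ A₁ := hsubA hx' ha'
  have hba₀ : ‖b - a₀‖ ≤ t := by
    rw [dist_eq_norm] at hx'd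
    simpa [hb, ha₀] using hx'd.le
  set K : ℝ := (24 + 16 * ‖b‖) * (t + 1) + 4 * ‖b‖ + 6 with hK
  have hK0 : 0 < K := by positivity
  set σ : ℝ := min 1 (ε / 2 / K) with hσ
  have hσ0 : 0 < σ := lt_min one_pos (by positivity)
  have hKσ : K * σ ≤ ε / 2 := by
    have h : σ ≤ ε / 2 / K := min_le_right _ _
    rwa [le_div_iff₀ hK0, mul_comm] at h
  obtain ⟨N, hN⟩ := exists_nat_one_div_lt hσ0
  have hη : (0 : ℝ) < σ ^ 2 / 2 := by positivity
  obtain ⟨ι, l, u, hl, huA, hu1, huₗ, huᵣ⟩ := hcai₁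
  have evₗ : ∀ d ∈ A₁, ∀ᶠ s in l, ‖u s * d - d‖ ≤ σ ^ 2 / 2 := fun d hd =>
    (huₗ d hd).eventually_le_const hη
  have evᵣ : ∀ d ∈ A₁, ∀ᶠ s in l, ‖d * u s - d‖ ≤ σ ^ 2 / 2 := fun d hd =>
    (huᵣ d hd).eventually_le_const hη
  obtain ⟨e, he, her⟩ := exists_seq_of_forall_finset_exists
    (fun y : X₁ => y ∈ A₁ ∧ ‖y‖ ≤ 1 ∧ ‖y * a₀ - a₀‖ ≤ σ ^ 2 / 2)
    (fun x y : X₁ => ‖y * x - x‖ ≤ σ ^ 2 / 2 ∧ ‖x * y - x‖ ≤ σ ^ 2 / 2 ∧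
      ‖y * (b * x) - b * x‖ ≤ σ ^ 2 / 2 ∧ ‖x * b * y - x * b‖ ≤ σ ^ 2 / 2) (by
    intro s hs
    have h : ∀ᶠ k in l, ‖u k * a₀ - a₀‖ ≤ σ ^ 2 / 2 ∧ ∀ x ∈ s,
        ‖u k * x - x‖ ≤ σ ^ 2 / 2 ∧ ‖x * u k - x‖ ≤ σ ^ 2 / 2 ∧
        ‖u k * (b * x) - b * x‖ ≤ σ ^ 2 / 2 ∧ ‖x * b * u k - x * b‖ ≤ σ ^ 2 / 2 := by
      refine (evₗ _ ha₀A).and ((Filter.eventually_all_finset s).2 fun x hx => ?_)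
      have hxA := (hs x hx).1
      exact (evₗ x hxA).and ((evᵣ x hxA).and
        ((evₗ _ (hA₁ideal x hxA b hbB).2).and (evᵣ _ (hA₁ideal x hxA b hbB).1)))
    obtain ⟨k, hk₁, hk₂⟩ := h.exists
    exact ⟨u k, ⟨huA k, hu1 k, hk₁⟩, hk₂⟩)
  obtain ⟨g, hg⟩ := exists_norm_add_conjugate_le (Nat.succ_pos N) hσ0 (min_le_left _ _)
    (by push_cast; exact hN.le) (fun i => (he i).2.1) (fun i j hij => (her i j hij).1)
    (fun i j hij => (her i j hij).2.1) (fun i j hij => (her i j hij).2.2.1)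
    (fun i j hij => (her i j hij).2.2.2) (fun i => (he i).2.2)
  set G := ∑ i ∈ Finset.range (N + 1), g i • e i with hG
  have hGA : G ∈ A₁ := by
    refine Finset.sum_induction _ (· ∈ A₁) (fun _ _ => hA₁.add_mem) hA₁.zero_mem fun i _ => ?_
    exact hA₁.smul_mem (g i : ℂ) (he i).1
  have hbe : b * e (N + 1) ∈ A₁ := (hA₁ideal _ (he _).1 _ hbB).2
  obtain ⟨a, haA, haρ, han⟩ := hAquot _ (hAmap _ hbe) (ε / 2) (by positivity)
  have hat : ‖a‖ ≤ t := by
    have h : ‖ρ (b * e (N + 1))‖ ≤ ‖b₂‖ := by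
      rw [hmul _ hbB _ (hA₁B (he _).1), hbρ]
      exact (norm_mul_le _ _).trans (mul_le_of_le_one_right (norm_nonneg _)
        ((hcontr _ (hA₁B (he _).1)).trans (he _).2.1))
    rw [ht]; linarith
  have hz : a - b * e (N + 1) ∈ A₁ := hsubA haA hbe
  have hzρ : ρ (a - b * e (N + 1)) = 0 := by
    rw [hρsub _ (hA₁B haA) _ (hA₁B hbe), haρ, sub_self]
  have hGz : G * (a - b * e (N + 1)) ∈ B₁ := hA₁B (hA₁.mul_mem hGA hz)
  have hGzG : G * (a - b * e (N + 1)) * G ∈ B₁ := hB₁.mul_mem hGz (hA₁B hGA)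
  refine ⟨b + G * (a - b * e (N + 1)) * G, hB₁.add_mem hbB hGzG, ?_, ?_⟩
  · rw [hadd _ hbB _ hGzG, hmul _ hGz _ (hA₁B hGA), hmul _ (hA₁B hGA) _ (hA₁B hz), hzρ, hbρ]
    simp
  · refine (hg a t hat hba₀).trans ?_
    rw [← hK, ht]
    linarith
end
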